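/- arXiv:0705.2371 — 3 statements merged into one kernel-verified Lean document; each statement's English description precedes it below -/
import Mathlib

section
/- Let S be a commutative ring and let m ≥ 2, n ≥ 1. For j = 1, …, m let C_j be an ((m−1)n) × n matrix over S and let B_j be an n × n matrix over S, and let A = (C_1 | ⋯ | C_m) be the ((m−1)n) × (mn) matrix whose j-th block column is C_j. Assume that Σ_{j=1}^m C_j · B_j = 0 (the zero ((m−1)n) × n matrix). For 1 ≤ k ≤ m write A_{k̂} for the square ((m−1)n) × ((m−1)n) matrix obtained from A by deleting the k-th block column. Then for all 1 ≤ k, k' ≤ m one has det(A_{k̂'}) · det(B_k) = (−1)^{n(k+k')} · det(A_{k̂}) · det(B_{k'}). -/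
/-- The order-preserving injection `Fin (m - 1) → Fin m` that skips the index `k`. -/
def skipIdx {m : ℕ} (k : Fin m) (j : Fin (m - 1)) : Fin m :=
  if (j : ℕ) < (k : ℕ) then ⟨(j : ℕ), by have := j.isLt; omega⟩
  else ⟨(j : ℕ) + 1, by have := j.isLt; omega⟩

open Equiv in
lemma aux_perm {M : ℕ} (k k' : Fin (M + 1)) (h : k ≠ k') :
    ∃ τ : Perm (Fin M), (∀ j, swap k k' (k'.succAbove (τ j)) = k.succAbove j) ∧
      (Perm.sign τ : ℤ) = -(-1) ^ ((k : ℕ) + (k' : ℕ)) := by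
  set ρ : Perm (Fin (M + 1)) := k'.cycleRange * swap k k' * k.cycleRange⁻¹ with hρ
  obtain ⟨⟨p, τ⟩, hτ⟩ := (Perm.decomposeFin (n := M)).symm.surjective ρ
  have hp : p = 0 := by
    have h0 : ρ 0 = p := by rw [← hτ]; simp
    rw [← h0, hρ]
    simp [Perm.mul_apply, Perm.inv_def, Fin.cycleRange_symm_zero, Fin.cycleRange_self]
  subst hp
  refine ⟨τ, fun j => ?_, ?_⟩
  · have h1 : ρ j.succ = (τ j).succ := by rw [← hτ]; simp
    rw [← Fin.cycleRange_symm_succ k', ← h1, hρ]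
    simp [Perm.mul_apply, Perm.inv_def, Fin.cycleRange_symm_succ]
  · have h2 : Perm.sign ρ = Perm.sign τ := by rw [← hτ, Perm.decomposeFin.symm_sign]; simp
    rw [← h2, hρ]
    simp [Perm.sign_mul, Perm.sign_swap h, Fin.sign_cycleRange, pow_add, mul_comm]

/-- Block identity with block column `a` replaced by the blocks `D`. -/
def auxE {S : Type*} [CommRing S] {M n : ℕ} (a : Fin M) (D : Fin M → Matrix (Fin n) (Fin n) S) :
    Matrix (Fin M × Fin n) (Fin M × Fin n) S :=
  Matrix.of fun x y => if y.1 = a then D x.1 x.2 y.2 else if x = y then 1 else 0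

def auxEquiv {M n : ℕ} (a : Fin M) : Fin n ≃ {x : Fin M × Fin n // ¬ (x.1 ≠ a)} where
  toFun i := ⟨(a, i), by simp⟩
  invFun x := x.1.2
  left_inv i := rfl
  right_inv := by
    rintro ⟨⟨x, i⟩, hx⟩
    have : x = a := by simpa using hx
    subst this; rfl

lemma auxE_det {S : Type*} [CommRing S] {M n : ℕ} (a : Fin M)
    (D : Fin M → Matrix (Fin n) (Fin n) S) : (auxE a D).det = (D a).det := by
  rw [Matrix.twoBlockTriangular_det (auxE a D) (fun x => x.1 ≠ a)]
  · have h1 : (auxE a D).toSquareBlockProp (fun x => x.1 ≠ a) = 1 := by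
      ext ⟨x, hx⟩ ⟨y, hy⟩
      simp [auxE, Matrix.toSquareBlockProp, hy, Matrix.one_apply]
    rw [h1, Matrix.det_one, one_mul, ← Matrix.det_submatrix_equiv_self (auxEquiv a)]
    congr 1
    ext i j
    simp [auxE, Matrix.toSquareBlockProp, auxEquiv]
  · intro x hx y hy
    have hx' : x.1 = a := by simpa using hx
    have : x ≠ y := by rintro rfl; exact hy hx'
    simp [auxE, hy, this]

lemma aux_mul {S : Type*} [CommRing S] {M n : ℕ} {R : Type*} (a : Fin M)
    (X : Fin M → Matrix R (Fin n) S) (D : Fin M → Matrix (Fin n) (Fin n) S) :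
    (Matrix.of fun (r : R) (y : Fin M × Fin n) => X y.1 r y.2) * auxE a D =
      Matrix.of fun r y => Function.update X a (∑ j, X j * D j) y.1 r y.2 := by
  ext r ⟨y, i⟩
  by_cases hy : y = a
  · subst hy
    simp [Matrix.mul_apply, auxE, Fintype.sum_prod_type, Matrix.sum_apply]
  · simp [Matrix.mul_apply, auxE, hy]

lemma aux_main {S : Type*} [CommRing S] {M n : ℕ}
    (C : Fin (M + 1) → Matrix (Fin M × Fin n) (Fin n) S)
    (B : Fin (M + 1) → Matrix (Fin n) (Fin n) S)
    (hCB : ∑ j, C j * B j = 0) (k k' : Fin (M + 1)) :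
    (Matrix.of fun (x y : Fin M × Fin n) => C (k'.succAbove y.1) x y.2).det * (B k).det =
      (-1 : S) ^ (n * ((k : ℕ) + (k' : ℕ))) *
        ((Matrix.of fun (x y : Fin M × Fin n) => C (k.succAbove y.1) x y.2).det
          * (B k').det) := by
  by_cases h : k = k'
  · subst h
    rw [Even.neg_one_pow ⟨n * k, by ring⟩, one_mul]
  obtain ⟨a, ha⟩ := Fin.exists_succAbove_eq h
  obtain ⟨τ, hτ, hs⟩ := aux_perm k k' h
  set Y : Fin M → Matrix (Fin M × Fin n) (Fin n) S :=
    fun j => C (Equiv.swap k k' (k'.succAbove j)) with hY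
  have e1 := congrArg Matrix.det (aux_mul a (fun j => C (k'.succAbove j))
    (fun j => B (k'.succAbove j)))
  have e2 := congrArg Matrix.det (aux_mul a Y (Pi.single a (-B k')))
  rw [Matrix.det_mul, auxE_det] at e1 e2
  have hN : Function.update (fun j => C (k'.succAbove j)) a
        (∑ j, C (k'.succAbove j) * B (k'.succAbove j)) =
      Function.update Y a (∑ j, Y j * (Pi.single a (-B k') : Fin M → Matrix (Fin n) (Fin n) S) j) := by
    have hsum : ∑ j, C (k'.succAbove j) * B (k'.succAbove j) = -(C k' * B k') := by
      rw [Fin.sum_univ_succAbove _ k'] at hCB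
      exact eq_neg_of_add_eq_zero_right hCB
    have hsum2 : ∑ j, Y j * (Pi.single a (-B k') : Fin M → Matrix (Fin n) (Fin n) S) j
        = -(C k' * B k') := by
      rw [Finset.sum_eq_single a]
      · simp [hY, ha]
      · intro j _ hj
        simp [hj]
      · simp
    rw [hsum, hsum2]
    ext j : 1
    by_cases hj : j = a
    · subst hj; simp
    · have h1 : k'.succAbove j ≠ k := fun h2 =>
        hj (Fin.succAbove_right_injective (h2.trans ha.symm))
      simp [hj, hY, Equiv.swap_apply_of_ne_of_ne h1 (Fin.succAbove_ne _ _)]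
  have e3 : (Matrix.of fun (x y : Fin M × Fin n) => C (k.succAbove y.1) x y.2) =
      (Matrix.of fun (x y : Fin M × Fin n) => Y y.1 x y.2).submatrix id
        (Equiv.prodCongrLeft (fun _ : Fin n => τ)) := by
    ext x y
    simp [hY, hτ, Equiv.prodCongrLeft]
  have hsS : (((Equiv.Perm.sign τ : ℤˣ) : ℤ) : S) = -(-1) ^ ((k : ℕ) + (k' : ℕ)) := by
    rw [hs]; push_cast; rfl
  rw [hN, ← e2] at e1
  simp only [ha, Pi.single_eq_same, Matrix.det_neg, Fintype.card_fin] at e1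
  rw [e1, e3, Matrix.det_permute', Equiv.Perm.sign_prodCongrLeft]
  simp only [Finset.prod_const, Finset.card_univ, Fintype.card_fin]
  push_cast
  rw [hsS, neg_pow ((-1 : S) ^ ((k : ℕ) + (k' : ℕ))) n, ← pow_mul, mul_comm n]
  have : ((-1 : S) ^ (((k : ℕ) + (k' : ℕ)) * n)) * ((-1 : S) ^ (((k : ℕ) + (k' : ℕ)) * n)) = 1 := by
    rw [← mul_pow]; simp
  linear_combination (-((-1 : S) ^ n * (Matrix.of fun (x y : Fin M × Fin n) => Y y.1 x y.2).det
    * (B k').det)) * this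

lemma skipIdx_eq {M : ℕ} (k : Fin (M + 1)) (j : Fin M) :
    skipIdx k j = k.succAbove j := by
  ext
  simp only [skipIdx, Fin.succAbove, Fin.lt_def, Fin.val_castSucc]
  split_ifs <;> rfl

/-- Let `S` be a commutative ring, `m ≥ 2`, `n ≥ 1`.  For `j : Fin m` let `C j` be an
`((m-1)n) × n` matrix and `B j` an `n × n` matrix over `S`, with `∑ j, C j * B j = 0`.
Let `A` be the `((m-1)n) × (mn)` matrix whose `j`-th block column is `C j`, and for `k : Fin m`
let `A_{k̂}` be the square matrix obtained from `A` by deleting the `k`-th block column (its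
columns being indexed, in order, via a fixed identification `e` of `Fin (m-1) × Fin n` with
`Fin ((m-1)n)`).  Then `det (A_{k̂'}) * det (B k) = (-1)^(n(k+k')) * det (A_{k̂}) * det (B k')`. -/
theorem stmt0 {S : Type*} [CommRing S] (m n : ℕ) (hm : 2 ≤ m) (hn : 1 ≤ n)
    (C : Fin m → Matrix (Fin ((m - 1) * n)) (Fin n) S)
    (B : Fin m → Matrix (Fin n) (Fin n) S)
    (hCB : ∑ j : Fin m, C j * B j = 0)
    (e : Fin (m - 1) × Fin n ≃ Fin ((m - 1) * n))
    (k k' : Fin m) :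
    (Matrix.of fun (i p : Fin ((m - 1) * n)) =>
        C (skipIdx k' (e.symm p).1) i (e.symm p).2).det * (B k).det =
      (-1 : S) ^ (n * ((k : ℕ) + (k' : ℕ))) *
        ((Matrix.of fun (i p : Fin ((m - 1) * n)) =>
            C (skipIdx k (e.symm p).1) i (e.symm p).2).det * (B k').det) := by
  obtain ⟨M, rfl⟩ : ∃ M, m = M + 1 := ⟨m - 1, by omega⟩
  have key := aux_main (M := M) (fun j => (C j).submatrix e id) B (by
    ext x y
    have := congrFun (congrFun hCB (e x)) y
    simpa [Matrix.sum_apply, Matrix.mul_apply] using this) k k'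
  have conv : ∀ l : Fin (M + 1), (Matrix.of fun (i p : Fin ((M + 1 - 1) * n)) =>
        C (skipIdx l (e.symm p).1) i (e.symm p).2).det =
      (Matrix.of fun (x y : Fin M × Fin n) =>
        ((C (l.succAbove y.1)).submatrix e id) x y.2).det := by
    intro l
    rw [← Matrix.det_submatrix_equiv_self e]
    congr 1
    ext x y
    simp only [Matrix.submatrix_apply, Matrix.of_apply, Equiv.symm_apply_apply, id]
    rw [← skipIdx_eq]
  rw [conv, conv]
  exact key
end

section
/- Let F be the free group on an index set ι and let ℤ[F] be its integral group ring. For every j ∈ ι there exists a unique ℤ-linear map D : ℤ[F] → ℤ[F] such that D(x_i) = 1 if i = j and D(x_i) = 0 if i ≠ j for the generators x_i of F, and D(g·h) = D(g) + g·D(h) for all group elements g, h ∈ F. -/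
theorem foxPerm_cancel {A : Type*} (f : Equiv.Perm A) (a : A) : f (f⁻¹ a) = a := by
  rw [← Equiv.Perm.mul_apply, mul_inv_cancel, Equiv.Perm.one_apply]

open Classical in
/-- The affine permutation `a ↦ x_i * a + δ_{ij}` of the group ring. -/
noncomputable def foxPerm (ι : Type*) (j i : ι) : Equiv.Perm (MonoidAlgebra ℤ (FreeGroup ι)) where
  toFun a := MonoidAlgebra.of ℤ (FreeGroup ι) (FreeGroup.of i) * a + (if i = j then 1 else 0)
  invFun a := MonoidAlgebra.of ℤ (FreeGroup ι) (FreeGroup.of i)⁻¹ * (a - (if i = j then 1 else 0))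
  left_inv a := by
    simp only [add_sub_cancel_right]
    rw [← mul_assoc, ← map_mul, inv_mul_cancel, map_one, one_mul]
  right_inv a := by
    beta_reduce
    rw [← mul_assoc, ← map_mul, mul_inv_cancel, map_one, one_mul, sub_add_cancel]

/-- The affine action of the free group on its group ring. -/
noncomputable def foxHom (ι : Type*) (j : ι) :
    FreeGroup ι →* Equiv.Perm (MonoidAlgebra ℤ (FreeGroup ι)) :=
  FreeGroup.lift (foxPerm ι j)

theorem foxHom_affine (ι : Type*) (j : ι) (g : FreeGroup ι) :
    ∀ a, foxHom ι j g a = MonoidAlgebra.of ℤ (FreeGroup ι) g * a + foxHom ι j g 0 := by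
  induction g using FreeGroup.induction_on with
  | C1 => intro a; rw [map_one, map_one]; simp
  | of i => intro a; simp [foxHom, foxPerm]
  | inv_of i ih =>
    intro a
    rw [map_inv]
    apply (foxHom ι j (FreeGroup.of i)).injective
    rw [ih (_ + _), mul_add, ← mul_assoc, ← map_mul, mul_inv_cancel, map_one, one_mul, add_assoc,
      ← ih, foxPerm_cancel, foxPerm_cancel, add_zero]
  | mul x y hx hy =>
    intro a
    rw [map_mul, map_mul, Equiv.Perm.mul_apply, Equiv.Perm.mul_apply, hx, hy a,
      hx (foxHom ι j y 0), mul_add, mul_assoc, add_assoc]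

/-- Let `F` be the free group on an index set `ι` and `ℤ[F]` its integral group ring.
For every `j ∈ ι` there is a unique `ℤ`-linear map `D : ℤ[F] → ℤ[F]` (the Fox derivative
with respect to the generator `x j`) such that `D (x j) = 1`, `D (x i) = 0` for `i ≠ j`,
and `D (g * h) = D g + g * D h` for all group elements `g, h ∈ F`. -/
theorem stmt3 (ι : Type*) (j : ι) :
    ∃! D : MonoidAlgebra ℤ (FreeGroup ι) →ₗ[ℤ] MonoidAlgebra ℤ (FreeGroup ι),
      (D (MonoidAlgebra.of ℤ (FreeGroup ι) (FreeGroup.of j)) = 1 ∧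
        ∀ i : ι, i ≠ j → D (MonoidAlgebra.of ℤ (FreeGroup ι) (FreeGroup.of i)) = 0) ∧
      ∀ g h : FreeGroup ι,
        D (MonoidAlgebra.of ℤ (FreeGroup ι) (g * h)) =
          D (MonoidAlgebra.of ℤ (FreeGroup ι) g) +
            MonoidAlgebra.of ℤ (FreeGroup ι) g *
              D (MonoidAlgebra.of ℤ (FreeGroup ι) h) := by
  classical
  refine ⟨(MonoidAlgebra.liftNC (Int.castAddHom _)
    (fun g => foxHom ι j g 0)).toIntLinearMap, ?_, ?_⟩
  · have key : ∀ g, (MonoidAlgebra.liftNC (Int.castAddHom _)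
        (fun g => foxHom ι j g 0)).toIntLinearMap (MonoidAlgebra.of ℤ (FreeGroup ι) g)
          = foxHom ι j g 0 := by
      intro g
      simp [MonoidAlgebra.of_apply, MonoidAlgebra.liftNC_single]
    refine ⟨⟨?_, ?_⟩, ?_⟩
    · rw [key]; simp [foxHom, foxPerm]
    · intro i hi
      rw [key]; simp [foxHom, foxPerm, hi]
    · intro g h
      rw [key, key, key, map_mul, Equiv.Perm.mul_apply, foxHom_affine, add_comm]
  · have gen : ∀ D E : MonoidAlgebra ℤ (FreeGroup ι) →ₗ[ℤ] MonoidAlgebra ℤ (FreeGroup ι),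
        (∀ g, D (MonoidAlgebra.of ℤ (FreeGroup ι) g) = E (MonoidAlgebra.of ℤ (FreeGroup ι) g)) →
        D = E := by
      intro D E h
      ext g : 2
      simpa [MonoidAlgebra.of_apply] using h g
    rintro D ⟨⟨h1, h2⟩, h3⟩
    apply gen
    intro g
    have hE : (MonoidAlgebra.liftNC (Int.castAddHom _)
        (fun g => foxHom ι j g 0)).toIntLinearMap (MonoidAlgebra.of ℤ (FreeGroup ι) g)
          = foxHom ι j g 0 := by
      simp [MonoidAlgebra.of_apply, MonoidAlgebra.liftNC_single]
    rw [hE]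
    clear hE
    have hone : D (MonoidAlgebra.of ℤ (FreeGroup ι) 1) = 0 := by
      have := h3 1 1
      rw [mul_one, map_one, one_mul] at this
      rw [map_one]
      exact left_eq_add.mp this
    have hof : ∀ i, D (MonoidAlgebra.of ℤ (FreeGroup ι) (FreeGroup.of i))
        = foxHom ι j (FreeGroup.of i) 0 := by
      intro i
      by_cases hi : i = j
      · subst hi; rw [h1]; simp [foxHom, foxPerm]
      · rw [h2 i hi]; simp [foxHom, foxPerm, hi]
    induction g using FreeGroup.induction_on with
    | C1 => rw [hone]; simp
    | of i => exact hof i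
    | inv_of i ih =>
      have := h3 (FreeGroup.of i) (FreeGroup.of i)⁻¹
      rw [mul_inv_cancel, hone, hof, add_comm, ← foxHom_affine] at this
      apply (foxHom ι j (FreeGroup.of i)).injective
      rw [← this, map_inv, foxPerm_cancel]
    | mul x y hx hy =>
      rw [h3, hx,
        hy, map_mul,
        Equiv.Perm.mul_apply, foxHom_affine ι j x (foxHom ι j y 0), add_comm]
end

section
/- Let 𝔽 be a field, n ≥ 1, and let P and Q be n × n matrices over 𝔽 such that PQ = QP and such that P − I_n is invertible. Define linear maps d₂ : 𝔽ⁿ → 𝔽ⁿ × 𝔽ⁿ by d₂(v) = ((Q − I_n)v, −(P − I_n)v) and d₁ : 𝔽ⁿ × 𝔽ⁿ → 𝔽ⁿ by d₁(a, b) = (P − I_n)a + (Q − I_n)b. Then d₂ is injective, d₁ is surjective, and the kernel of d₁ equals the image of d₂ (so the complex 0 → 𝔽ⁿ → 𝔽ⁿ × 𝔽ⁿ → 𝔽ⁿ → 0 is exact). -/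
/-- Let `𝔽` be a field, `n ≥ 1`, and `P`, `Q` commuting `n × n` matrices over `𝔽` such that
`P - 1` is invertible.  Define `d₂ : 𝔽ⁿ → 𝔽ⁿ × 𝔽ⁿ` by `d₂ v = ((Q - 1) v, -(P - 1) v)` and
`d₁ : 𝔽ⁿ × 𝔽ⁿ → 𝔽ⁿ` by `d₁ (a, b) = (P - 1) a + (Q - 1) b`.  Then `d₂` is injective, `d₁` is
surjective, and `ker d₁ = im d₂`, i.e. the complex `0 → 𝔽ⁿ → 𝔽ⁿ × 𝔽ⁿ → 𝔽ⁿ → 0` is exact. -/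
theorem stmt10 (𝔽 : Type*) [Field 𝔽] (n : ℕ) (hn : 1 ≤ n)
    (P Q : Matrix (Fin n) (Fin n) 𝔽)
    (hcomm : P * Q = Q * P) (hP : IsUnit (P - 1)) :
    Function.Injective
      (fun v : Fin n → 𝔽 => ((Q - 1).mulVec v, -((P - 1).mulVec v))) ∧
    Function.Surjective
      (fun ab : (Fin n → 𝔽) × (Fin n → 𝔽) => (P - 1).mulVec ab.1 + (Q - 1).mulVec ab.2) ∧
    ∀ ab : (Fin n → 𝔽) × (Fin n → 𝔽),
      (P - 1).mulVec ab.1 + (Q - 1).mulVec ab.2 = 0 ↔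
        ∃ v : Fin n → 𝔽, ((Q - 1).mulVec v, -((P - 1).mulVec v)) = ab := by
  have hinj : Function.Injective (P - 1).mulVec := Matrix.mulVec_injective_of_isUnit hP
  have hsurj : Function.Surjective (P - 1).mulVec := Matrix.mulVec_surjective_iff_isUnit.mpr hP
  have hAB : (P - 1) * (Q - 1) = (Q - 1) * (P - 1) := by
    simp only [sub_mul, mul_sub, hcomm, one_mul, mul_one]
    abel
  have hABv : ∀ v : Fin n → 𝔽,
      (P - 1).mulVec ((Q - 1).mulVec v) = (Q - 1).mulVec ((P - 1).mulVec v) := by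
    intro v
    rw [Matrix.mulVec_mulVec, Matrix.mulVec_mulVec, hAB]
  refine ⟨?_, ?_, ?_⟩
  · intro v w h
    exact hinj (neg_injective (Prod.ext_iff.mp h).2)
  · intro w
    obtain ⟨a, ha⟩ := hsurj w
    exact ⟨(a, 0), by simp only [Matrix.mulVec_zero, add_zero, ha]⟩
  · rintro ⟨a, b⟩
    constructor
    · intro h
      obtain ⟨v, hv⟩ := hsurj (-b)
      refine ⟨v, Prod.ext (hinj ?_) ?_⟩
      · show (P - 1).mulVec ((Q - 1).mulVec v) = (P - 1).mulVec a
        rw [hABv, hv, Matrix.mulVec_neg]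
        exact (eq_neg_of_add_eq_zero_left h).symm
      · show -((P - 1).mulVec v) = b
        rw [hv, neg_neg]
    · rintro ⟨v, hv⟩
      obtain ⟨rfl, rfl⟩ := Prod.mk.inj hv
      show (P - 1).mulVec ((Q - 1).mulVec v) + (Q - 1).mulVec (-((P - 1).mulVec v)) = 0
      rw [hABv, Matrix.mulVec_neg, add_neg_cancel]
end
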